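/- There exists a C^∞ function Ψ : ℝ → ℝ such that: Ψ(x+1) = Ψ(x) + 2 for all x ∈ ℝ; Ψ'(x) > 1 for all x ∈ ℝ; Ψ(0) = 0; Ψ'(0) > 2; and the induced degree-two expanding map of the circle ℝ/ℤ preserves the Haar (Lebesgue) probability measure — equivalently, for all a, b ∈ [0,1) with a ≠ b and Ψ(a) − Ψ(b) ∈ ℤ, one has 1/Ψ'(a) + 1/Ψ'(b) = 1. In particular, there is a Lebesgue-preserving C^∞ expanding circle map of degree 2 having a fixed point at which the derivative is strictly larger than 2. -/

import Mathlib

open Set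

/-- The inverse of the lift: a perturbation of `y ↦ y / 2` whose derivatives at `y` and `y + 1`
sum to `1`. -/
noncomputable def inverseLift (y : ℝ) : ℝ := y / 2 - Real.sin (Real.pi * y) / (4 * Real.pi)

theorem hasDerivAt_inverseLift (y : ℝ) :
    HasDerivAt inverseLift (1 / 2 - Real.cos (Real.pi * y) / 4) y := by
  have h := ((hasDerivAt_id y).div_const 2).sub
    ((((hasDerivAt_id y).const_mul Real.pi).sin).div_const (4 * Real.pi))
  refine h.congr_deriv ?_
  simp only [id]
  field_simp [Real.pi_ne_zero]

theorem contDiff_inverseLift {n : WithTop ℕ∞} : ContDiff ℝ n inverseLift := by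
  unfold inverseLift
  fun_prop

theorem strictMono_inverseLift : StrictMono inverseLift := by
  refine strictMono_of_deriv_pos fun y => ?_
  rw [(hasDerivAt_inverseLift y).deriv]
  linarith [Real.cos_le_one (Real.pi * y)]

theorem inverseLift_add_two (y : ℝ) : inverseLift (y + 2) = inverseLift y + 1 := by
  unfold inverseLift
  rw [show Real.pi * (y + 2) = Real.pi * y + 2 * Real.pi by ring, Real.sin_add_two_pi]
  ring

theorem abs_inverseLift_sub_le (y : ℝ) : |inverseLift y - y / 2| ≤ 1 := by
  have h : |Real.sin (Real.pi * y) / (4 * Real.pi)| ≤ 1 := by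
    rw [abs_div, abs_of_pos (by positivity : 0 < 4 * Real.pi), div_le_one (by positivity)]
    linarith [Real.abs_sin_le_one (Real.pi * y), Real.pi_gt_three]
  simpa [inverseLift] using h

theorem surjective_inverseLift : Function.Surjective inverseLift := by
  intro x
  refine mem_range_of_exists_le_of_exists_ge (contDiff_inverseLift (n := 0)).continuous
    ⟨2 * x - 2, ?_⟩ ⟨2 * x + 2, ?_⟩
  · linarith [(abs_le.1 (abs_inverseLift_sub_le (2 * x - 2))).2]
  · linarith [(abs_le.1 (abs_inverseLift_sub_le (2 * x + 2))).1]

/-- The inverse of the lift as a homeomorphism of the line. -/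
noncomputable def inverseLiftHomeomorph : ℝ ≃ₜ ℝ :=
  (strictMono_inverseLift.orderIsoOfSurjective _ surjective_inverseLift).toHomeomorph

theorem coe_inverseLiftHomeomorph : ⇑inverseLiftHomeomorph = inverseLift := rfl

theorem inverseLift_symm_apply (x : ℝ) : inverseLift (inverseLiftHomeomorph.symm x) = x :=
  inverseLiftHomeomorph.apply_symm_apply x

theorem inverseLift_deriv_pos (y : ℝ) : 0 < 1 / 2 - Real.cos (Real.pi * y) / 4 := by
  linarith [Real.cos_le_one (Real.pi * y)]

theorem deriv_inverseLiftHomeomorph_symm (x : ℝ) :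
    deriv inverseLiftHomeomorph.symm x =
      (1 / 2 - Real.cos (Real.pi * inverseLiftHomeomorph.symm x) / 4)⁻¹ :=
  (HasDerivAt.of_local_left_inverse inverseLiftHomeomorph.symm.continuous.continuousAt
    (hasDerivAt_inverseLift _) (inverseLift_deriv_pos _).ne'
    (Filter.Eventually.of_forall inverseLift_symm_apply)).deriv

/-- **Example.** There is a C^∞, Lebesgue-measure-preserving expanding circle map of
degree 2 (given by a lift `Ψ : ℝ → ℝ` with `Ψ(x+1) = Ψ(x) + 2` and `Ψ' > 1`) fixing `0`
with derivative strictly larger than `2` there. Measure preservation is expressed by the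
reciprocal-derivative identity over the two preimages of each point. -/
theorem exists_volumePreserving_expanding_circle_map :
    ∃ Ψ : ℝ → ℝ,
      (∀ m : ℕ, ContDiff ℝ m Ψ) ∧
      (∀ x : ℝ, Ψ (x + 1) = Ψ x + 2) ∧
      (∀ x : ℝ, 1 < deriv Ψ x) ∧
      Ψ 0 = 0 ∧
      2 < deriv Ψ 0 ∧
      ∀ a b : ℝ, a ∈ Set.Ico (0 : ℝ) 1 → b ∈ Set.Ico (0 : ℝ) 1 → a ≠ b →
        (∃ m : ℤ, Ψ a - Ψ b = (m : ℝ)) →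
        1 / deriv Ψ a + 1 / deriv Ψ b = 1 := by
  have map_zero : inverseLiftHomeomorph.symm 0 = 0 := by
    rw [Homeomorph.symm_apply_eq, coe_inverseLiftHomeomorph]
    simp [inverseLift]
  have map_add_one (x : ℝ) :
      inverseLiftHomeomorph.symm (x + 1) = inverseLiftHomeomorph.symm x + 2 := by
    rw [Homeomorph.symm_apply_eq, coe_inverseLiftHomeomorph, inverseLift_add_two,
      inverseLift_symm_apply]
  have mono : StrictMono inverseLiftHomeomorph.symm :=
    (strictMono_inverseLift.orderIsoOfSurjective _ surjective_inverseLift).symm.strictMono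
  refine ⟨inverseLiftHomeomorph.symm, fun m => ?_, map_add_one, fun x => ?_, map_zero, ?_, ?_⟩
  · exact inverseLiftHomeomorph.contDiff_symm_deriv (fun y => (inverseLift_deriv_pos y).ne')
      hasDerivAt_inverseLift contDiff_inverseLift
  · rw [deriv_inverseLiftHomeomorph_symm]
    refine (one_lt_inv₀ (inverseLift_deriv_pos _)).2 ?_
    linarith [Real.neg_one_le_cos (Real.pi * inverseLiftHomeomorph.symm x)]
  · rw [deriv_inverseLiftHomeomorph_symm, map_zero]
    norm_num
  · rintro a b ⟨ha0, ha1⟩ ⟨hb0, hb1⟩ hab ⟨m, hm⟩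
    have map_one : inverseLiftHomeomorph.symm 1 = 2 := by
      simpa [map_zero] using map_add_one 0
    have hu0 := mono.monotone ha0
    have hu1 := mono ha1
    have hv0 := mono.monotone hb0
    have hv1 := mono hb1
    have huv : inverseLiftHomeomorph.symm a ≠ inverseLiftHomeomorph.symm b :=
      mono.injective.ne hab
    simp only [deriv_inverseLiftHomeomorph_symm, one_div, inv_inv]
    rw [map_zero] at hu0 hv0
    rw [map_one] at hu1 hv1
    generalize inverseLiftHomeomorph.symm a = u at *
    generalize inverseLiftHomeomorph.symm b = v at *
    have hm_lt : m < 2 := by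
      have : (m : ℝ) < 2 := by linarith
      exact_mod_cast this
    have hm_gt : -2 < m := by
      have : (-2 : ℝ) < m := by linarith
      exact_mod_cast this
    have hm_ne : m ≠ 0 := by
      rintro rfl
      exact huv (sub_eq_zero.1 (by simpa using hm))
    obtain rfl | rfl : m = 1 ∨ m = -1 := by omega
    · obtain rfl : u = v + 1 := by push_cast at hm; linarith
      rw [mul_add, mul_one, Real.cos_add_pi]
      ring
    · obtain rfl : v = u + 1 := by push_cast at hm; linarith
      rw [mul_add, mul_one, Real.cos_add_pi]
      ring
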